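/- Let 1 ≤ r ≤ n and let M be a finite-dimensional A-module. Then M is projective (equivalently, free) as an A-module if and only if for every r-dimensional subspace U ⊆ V the restriction α_U^*(M) is free as a C-module. -/

import Mathlib

open scoped TensorProduct

set_option synthInstance.maxHeartbeats 1000000
set_option maxHeartbeats 1000000

noncomputable section

def truncIdeal (k : Type*) [Field k] (n p : ℕ) : Ideal (MvPolynomial (Fin n) k) :=
  Ideal.span (Set.range fun i : Fin n => (MvPolynomial.X i : MvPolynomial (Fin n) k) ^ p)

abbrev TruncAlg (k : Type*) [Field k] (n p : ℕ) :=
  MvPolynomial (Fin n) k ⧸ truncIdeal k n p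

def xGen (k : Type*) [Field k] (n p : ℕ) (i : Fin n) : TruncAlg k n p :=
  Ideal.Quotient.mk (truncIdeal k n p) (MvPolynomial.X i)

def radIdeal (k : Type*) [Field k] (n p : ℕ) : Ideal (TruncAlg k n p) :=
  Ideal.span (Set.range (xGen k n p))

def xSpan (k : Type*) [Field k] (n p : ℕ) : Submodule k (TruncAlg k n p) :=
  Submodule.span k (Set.range (xGen k n p))

def IsFreeVia {C A : Type*} [CommRing C] [CommRing A] (α : C →+* A)
    (M : Type*) [AddCommGroup M] [Module A M] : Prop :=
  letI : Module C M := Module.compHom M α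
  Module.Free C M

def smulLinear (k : Type*) {A : Type*} (M : Type*) [CommSemiring k] [Semiring A]
    [AddCommMonoid M] [Module k M] [Module A M] [SMulCommClass k A M] (a : A) :
    M →ₗ[k] M where
  toFun m := a • m
  map_add' x y := smul_add a x y
  map_smul' c m := (smul_comm c a m).symm

def radPow (k A M : Type*) [CommSemiring k] [CommRing A] [AddCommMonoid M]
    [Module k M] [Module A M] [SMulCommClass k A M] (U : Set A) (j : ℕ) :
    Submodule k M :=
  ⨆ (u : Fin j → A) (_ : ∀ i, u i ∈ U), LinearMap.range (smulLinear k M (∏ i, u i))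

def socPow (k A M : Type*) [CommSemiring k] [CommRing A] [AddCommMonoid M]
    [Module k M] [Module A M] [SMulCommClass k A M] (U : Set A) (j : ℕ) :
    Submodule k M :=
  ⨅ (u : Fin j → A) (_ : ∀ i, u i ∈ U), LinearMap.ker (smulLinear k M (∏ i, u i))

/-- Every element of `M` annihilated by `S` is a multiple of `N`. -/
def AnnihilatorExact {R : Type*} [CommRing R] (S : Set R) (N : R) (M : Type*) [AddCommGroup M]
    [Module R M] : Prop :=
  ∀ m : M, (∀ s ∈ S, s • m = 0) → ∃ w : M, m = N • w

theorem geom_sum₂_eq_sub_pow_char_sub_one (p : ℕ) [Fact p.Prime] {R : Type*} [CommRing R]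
    [CharP R p] (x y : R) :
    ∑ i ∈ Finset.range p, x ^ i * y ^ (p - 1 - i) = (x - y) ^ (p - 1) := by
  have hp : p ≠ 0 := (Fact.out : p.Prime).ne_zero
  let X : MvPolynomial (Fin 2) (ZMod p) := MvPolynomial.X 0
  let Y : MvPolynomial (Fin 2) (ZMod p) := MvPolynomial.X 1
  have hXY : X - Y ≠ 0 := by
    intro h
    have h' : X = Y := sub_eq_zero.1 h
    exact absurd (MvPolynomial.X_injective h') (by decide)
  have key : ∑ i ∈ Finset.range p, X ^ i * Y ^ (p - 1 - i) = (X - Y) ^ (p - 1) := by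
    apply mul_right_cancel₀ hXY
    rw [(Commute.all X Y).geom_sum₂_mul, ← pow_succ, Nat.sub_add_cancel (Nat.pos_of_ne_zero hp),
      sub_pow_char]
  let : Algebra (ZMod p) R := ZMod.algebra R p
  have := congrArg (MvPolynomial.aeval ![x, y]) key
  simpa [X, Y] using this

theorem exists_sub_pow_char_sub_one_eq (p : ℕ) [Fact p.Prime] {R : Type*} [CommRing R]
    [CharP R p] (x y : R) :
    ∃ T : R, (x - y) ^ (p - 1) = x ^ (p - 1) + y * T ∧
      (x - y) ^ (p - 1) = x * T + y ^ (p - 1) := by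
  obtain ⟨q, hq⟩ : ∃ q, p = q + 1 := ⟨p - 1, by have := (Fact.out : p.Prime).pos; omega⟩
  refine ⟨∑ i ∈ Finset.range q, x ^ i * y ^ (q - 1 - i), ?_, ?_⟩
  · rw [← geom_sum₂_eq_sub_pow_char_sub_one p x y, hq]
    simp only [Nat.add_sub_cancel]
    exact (Commute.all x y).geom_sum₂_succ_eq
  · rw [← geom_sum₂_eq_sub_pow_char_sub_one p x y, hq]
    simp only [Nat.add_sub_cancel]
    rw [Finset.sum_range_succ', Finset.mul_sum]
    simp only [pow_zero, one_mul, Nat.sub_zero, add_left_inj]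
    refine Finset.sum_congr rfl fun i _ => ?_
    rw [show q - (i + 1) = q - 1 - i by omega]
    ring

theorem AnnihilatorExact.pow {p : ℕ} {R : Type*} [CommRing R] {M : Type*} [AddCommGroup M]
    [Module R M] {y : R} (h : AnnihilatorExact {y} (y ^ (p - 1)) M) (j : ℕ) (hj : j < p) :
    AnnihilatorExact {y ^ j} (y ^ (p - j)) M := by
  induction j with
  | zero =>
    intro m hm
    exact ⟨0, by simpa using hm⟩
  | succ j ih =>
    intro m hm
    have hm : y ^ (j + 1) • m = 0 := hm _ rfl
    obtain ⟨w, hw⟩ := h (y ^ j • m) (by rintro _ rfl; rwa [smul_smul, ← pow_succ'])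
    obtain ⟨v, hv⟩ := ih (by omega) (m - y ^ (p - 1 - j) • w) (by
      rintro _ rfl
      rw [smul_sub, smul_smul, ← pow_add, show j + (p - 1 - j) = p - 1 by omega, ← hw, sub_self])
    refine ⟨w + y • v, ?_⟩
    rw [smul_add, smul_smul, ← pow_succ, show p - (j + 1) + 1 = p - j by omega, ← hv,
      show p - (j + 1) = p - 1 - j by omega]
    abel

/-- The two-generator case of Dade's lemma. -/
theorem annihilatorExact_pair {k : Type*} [Field k] [IsAlgClosed k] (p : ℕ) [Fact p.Prime]
    {R : Type*} [CommRing R] [CharP R p] [Algebra k R] {M : Type*} [AddCommGroup M] [Module k M]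
    [Module R M] [IsScalarTower k R M] [FiniteDimensional k M] (x y : R)
    (hx : x ^ p = 0) (hy : y ^ p = 0) (hyM : AnnihilatorExact {y} (y ^ (p - 1)) M)
    (hM : ∀ c : k, AnnihilatorExact {x - c • y} ((x - c • y) ^ (p - 1)) M) :
    AnnihilatorExact {x, y} (x ^ (p - 1) * y ^ (p - 1)) M := by
  have hp : 1 < p := (Fact.out : p.Prime).one_lt
  have hx' : x * x ^ (p - 1) = 0 := by rw [← pow_succ', Nat.sub_add_cancel hp.le, hx]
  have hy' : y * y ^ (p - 1) = 0 := by rw [← pow_succ', Nat.sub_add_cancel hp.le, hy]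
  let act (a : R) : M →ₗ[k] M := Algebra.lsmul k k M a
  -- linear sections of `y ^ (p - 1)` on `ker y` and of `y` on `ker (y ^ (p - 1))`
  have sec (a : R) : ∃ s : M →ₗ[k] M, ∀ m : M, (∃ w, m = a • w) → a • s m = m := by
    obtain ⟨s, hs⟩ := (act a).rangeRestrict.exists_rightInverse_of_surjective
      (LinearMap.range_rangeRestrict _)
    obtain ⟨s', hs'⟩ := s.exists_extend
    refine ⟨s', ?_⟩
    rintro m ⟨w, rfl⟩
    have h1 := LinearMap.congr_fun hs' ⟨a • w, w, rfl⟩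
    have h2 := congrArg Subtype.val (LinearMap.congr_fun hs ⟨a • w, w, rfl⟩)
    simp only [LinearMap.comp_apply, Submodule.subtype_apply] at h1
    rw [h1]
    exact h2
  obtain ⟨s, hs⟩ := sec (y ^ (p - 1))
  obtain ⟨t, ht⟩ := sec y
  have hyM' : ∀ m : M, y ^ (p - 1) • m = 0 → ∃ w, m = y • w := fun m hm => by
    obtain ⟨w, hw⟩ := hyM.pow (p - 1) (by omega) m (by rintro _ rfl; exact hm)
    rw [show p - (p - 1) = 1 by omega, pow_one] at hw
    exact ⟨w, hw⟩
  let soc : Submodule k M := LinearMap.ker (act x) ⊓ LinearMap.ker (act y)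
  have mem_soc (m : M) : m ∈ soc ↔ x • m = 0 ∧ y • m = 0 := Iff.rfl
  let P : Submodule k soc := (LinearMap.range (act (x ^ (p - 1) * y ^ (p - 1)))).comap soc.subtype
  have mem_P (m : soc) : m ∈ P ↔ ∃ w, (x ^ (p - 1) * y ^ (p - 1)) • w = (m : M) := Iff.rfl
  have hsm (m : M) (hm : m ∈ soc) : y ^ (p - 1) • s m = m :=
    hs m (hyM m (by rintro _ rfl; exact hm.2))
  have htm (m : M) (hm : m ∈ soc) : y • t (x • s m) = x • s m := by
    refine ht _ (hyM' _ ?_)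
    rw [smul_comm, hsm m hm]
    exact hm.1
  let φ₀ : M →ₗ[k] M := act (x ^ (p - 1)) ∘ₗ t ∘ₗ act x ∘ₗ s
  have φ₀_apply (m : M) : φ₀ m = x ^ (p - 1) • t (x • s m) := rfl
  have hφ₀ (m : M) (hm : m ∈ soc) : φ₀ m ∈ soc := by
    rw [mem_soc, φ₀_apply]
    refine ⟨by rw [smul_smul, hx', zero_smul], ?_⟩
    rw [smul_comm, htm m hm, smul_smul, mul_comm, hx', zero_smul]
  let φ : soc →ₗ[k] soc := φ₀.restrict hφ₀
  have hφP : P ≤ P.comap φ := by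
    rintro ⟨m, hm⟩ ⟨w, hw⟩
    change (x ^ (p - 1) * y ^ (p - 1)) • w = m at hw
    change ∃ w', (x ^ (p - 1) * y ^ (p - 1)) • w' = φ₀ m
    obtain ⟨v, hv⟩ := hyM' (s m - x ^ (p - 1) • w) (by
      rw [smul_sub, hsm m hm, ← hw, smul_smul, mul_comm, sub_self])
    obtain ⟨v', hv'⟩ := hyM (t (x • s m) - x • v) (by
      rintro _ rfl
      rw [smul_sub, htm m hm, smul_comm _ x v, ← hv, smul_sub, smul_smul, hx', zero_smul, sub_zero,
        sub_self])
    refine ⟨v', ?_⟩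
    rw [φ₀_apply, mul_smul, ← hv', smul_sub, smul_smul, mul_comm _ x, hx', zero_smul, sub_zero]
  by_contra hcon
  have hne : Nontrivial (soc ⧸ P) := by
    rw [Submodule.Quotient.nontrivial_iff]
    intro htop
    refine hcon fun m hm => ?_
    have hmP : (⟨m, hm x (by simp), hm y (by simp)⟩ : soc) ∈ P := htop ▸ Submodule.mem_top
    obtain ⟨w, hw⟩ := (mem_P _).1 hmP
    exact ⟨w, hw.symm⟩
  obtain ⟨c, hc⟩ := Module.End.exists_eigenvalue (P.mapQ P φ hφP)
  obtain ⟨q, hq⟩ := hc.exists_hasEigenvector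
  obtain ⟨m, rfl⟩ := P.mkQ_surjective q
  have hqm := hq.apply_eq_smul
  have hmP : m ∉ P := fun h => hq.2 (by simpa using h)
  rw [Submodule.mkQ_apply, Submodule.mapQ_apply, ← Submodule.Quotient.mk_smul,
    Submodule.Quotient.eq, mem_P] at hqm
  obtain ⟨w, hw⟩ := hqm
  obtain ⟨m, hm⟩ := m
  change (x ^ (p - 1) * y ^ (p - 1)) • w = x ^ (p - 1) • t (x • s m) - c • m at hw
  obtain ⟨l, hl⟩ := IsAlgClosed.exists_pow_nat_eq c (n := p) (by omega)
  apply hmP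
  rw [mem_P]
  change ∃ w, _ = m
  set m₁ := s m with hm₁
  set m₂ := t (x • m₁) - y ^ (p - 1) • w with hm₂
  have e₁ : y ^ (p - 1) • m₁ = m := hsm m hm
  have e₂ : y • m₂ = x • m₁ := by
    rw [hm₂, smul_sub, htm m hm, smul_smul, hy', zero_smul, sub_zero]
  have e₃ : x ^ (p - 1) • m₂ = c • m := by
    rw [hm₂, smul_sub, smul_smul, hw]; abel
  obtain ⟨T, hT₁, hT₂⟩ := exists_sub_pow_char_sub_one_eq p x (l • y)
  set z := x - l • y with hz
  have e₄ : z ^ (p - 1) • (m₂ - l • m₁) = 0 := by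
    have h1 : z ^ (p - 1) • m₂ = c • m + (l • T) • x • m₁ := by
      rw [hT₁, add_smul, e₃, ← e₂, smul_smul, smul_mul_assoc, smul_mul_assoc, mul_comm T]
    have h2 : z ^ (p - 1) • l • m₁ = (l • T) • x • m₁ + c • m := by
      rw [smul_comm _ l m₁, hT₂, add_smul, smul_pow, smul_assoc, e₁, smul_add, smul_smul l,
        ← pow_succ', Nat.sub_add_cancel hp.le, hl, mul_comm, mul_smul, smul_assoc]
    rw [smul_sub, h1, h2]; abel
  obtain ⟨m₃, hm₃⟩ := (hM l).pow (p - 1) (by omega) (m₂ - l • m₁) (by rintro _ rfl; exact e₄)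
  rw [show p - (p - 1) = 1 by omega, pow_one] at hm₃
  obtain ⟨m₄, hm₄⟩ := hM l (m₁ - y • m₃) (by
    rintro _ rfl
    rw [smul_sub, smul_comm _ y m₃, ← hm₃, sub_smul, smul_sub, e₂, smul_assoc, smul_comm y l m₁,
      sub_self])
  refine ⟨m₄, ?_⟩
  have e₅ : x ^ (p - 1) * y ^ (p - 1) = y ^ (p - 1) * z ^ (p - 1) := by
    rw [hT₁, mul_add, mul_comm, smul_mul_assoc, mul_smul_comm, ← mul_assoc, mul_comm _ y, hy',
      zero_mul, smul_zero, add_zero]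
  rw [e₅, mul_smul, ← hm₄, smul_sub, e₁, smul_smul, mul_comm _ y, hy', zero_smul, sub_zero]

theorem LinearIndependent.finCons_sub_smul {k R : Type*} [Field k] [AddCommGroup R]
    [Module k R] {m : ℕ} {u : Fin (m + 2) → R} (hu : LinearIndependent k u) (c : k) :
    LinearIndependent k
      (Fin.cons (u 0 - c • u 1) fun i : Fin m => u i.succ.succ : Fin (m + 1) → R) := by
  rw [← Fin.cons_self_tail u, linearIndependent_finCons] at hu
  have hu' := hu.1
  rw [← Fin.cons_self_tail (Fin.tail u), linearIndependent_finCons] at hu'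
  refine linearIndependent_finCons.2 ⟨hu'.1, fun h => hu.2 ?_⟩
  have h0 : Submodule.span k (Set.range fun i : Fin m => u i.succ.succ) ≤
      Submodule.span k (Set.range (Fin.tail u)) :=
    Submodule.span_mono (by rintro _ ⟨i, rfl⟩; exact ⟨i.succ, rfl⟩)
  have h1 : u 1 ∈ Submodule.span k (Set.range (Fin.tail u)) :=
    Submodule.subset_span ⟨0, rfl⟩
  have := add_mem (h0 h) (Submodule.smul_mem _ c h1)
  rwa [sub_add_cancel] at this

/-- **Dade's lemma**: exactness along every line of `W` implies exactness for every linearly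
independent family in `W`. -/
theorem annihilatorExact_of_forall_singleton {k : Type*} [Field k] [IsAlgClosed k] (p : ℕ)
    [Fact p.Prime] {R : Type*} [CommRing R] [CharP R p] [Algebra k R] {M : Type*}
    [AddCommGroup M] [Module k M] [Module R M] [IsScalarTower k R M] [FiniteDimensional k M]
    (W : Submodule k R) (hW : ∀ u ∈ W, u ^ p = 0)
    (hM : ∀ u ∈ W, u ≠ 0 → AnnihilatorExact {u} (u ^ (p - 1)) M) (m : ℕ) (u : Fin m → R)
    (huW : ∀ i, u i ∈ W) (hu : LinearIndependent k u) :
    AnnihilatorExact (Set.range u) (∏ i, u i ^ (p - 1)) M := by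
  have hp : 1 < p := (Fact.out : p.Prime).one_lt
  induction m using Nat.twoStepInduction with
  | zero => exact fun w _ => ⟨w, by simp⟩
  | one =>
    intro w hw
    obtain ⟨v, hv⟩ := hM (u 0) (huW 0) (hu.ne_zero 0) w (by rintro _ rfl; exact hw _ ⟨0, rfl⟩)
    exact ⟨v, by simpa using hv⟩
  | more m ih ih' =>
    let u' : Fin m → R := fun i => u i.succ.succ
    let N : R := ∏ i, u' i ^ (p - 1)
    have hN (i : Fin m) : u' i * N = 0 := by
      have : u' i ^ (p - 1) ∣ N := Finset.dvd_prod_of_mem _ (Finset.mem_univ i)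
      obtain ⟨a, ha⟩ := this
      rw [ha, ← mul_assoc, ← pow_succ', Nat.sub_add_cancel hp.le, hW _ (huW _), zero_mul]
    let K : Submodule R M :=
      { carrier := {w | ∀ i, u' i • w = 0}
        add_mem' := fun ha hb i => by rw [smul_add, ha i, hb i, add_zero]
        zero_mem' := fun i => smul_zero _
        smul_mem' := fun c w hw i => by rw [smul_comm, hw i, smul_zero] }
    have : FiniteDimensional k K := inferInstanceAs (FiniteDimensional k (K.restrictScalars k))
    have hu1 : LinearIndependent k (Fin.tail u) := by
      rw [← Fin.cons_self_tail u, linearIndependent_finCons] at hu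
      exact hu.1
    have hu' : LinearIndependent k u' := hu1.comp _ (Fin.succ_injective _)
    have hK (z : R) (hz : z ∈ W) (hzu : LinearIndependent k (Fin.cons z u' : Fin (m + 1) → R)) :
        AnnihilatorExact {z} (z ^ (p - 1)) K := by
      rintro ⟨w, hwK⟩ hw
      have hw : z • w = 0 := congrArg Subtype.val (hw z rfl)
      obtain ⟨v, hv⟩ := ih' (Fin.cons z u') (fun i => by
        refine Fin.cases ?_ (fun i => ?_) i
        · simpa using hz
        · simpa using huW _) hzu w (by
        rintro _ ⟨i, rfl⟩
        refine Fin.cases ?_ (fun i => ?_) i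
        · simpa using hw
        · simpa using hwK i)
      refine ⟨⟨N • v, fun i => by rw [smul_smul, hN, zero_smul]⟩, Subtype.ext ?_⟩
      rw [Fin.prod_univ_succ] at hv
      simpa [mul_smul] using hv
    have hpair := annihilatorExact_pair (k := k) p (M := K) (u 0) (u 1) (hW _ (huW 0))
      (hW _ (huW 1))
      (hK _ (huW 1) (by
        have : (Fin.cons (u 1) u' : Fin (m + 1) → R) = Fin.tail u := Fin.cons_self_tail (Fin.tail u)
        rwa [this]))
      (fun c => hK _ (W.sub_mem (huW 0) (W.smul_mem c (huW 1))) (hu.finCons_sub_smul c))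
    intro w hw
    obtain ⟨⟨v, hvK⟩, hv⟩ := hpair ⟨w, fun i => hw _ ⟨_, rfl⟩⟩ (by
      rintro _ (rfl | rfl)
      · exact Subtype.ext (hw _ ⟨0, rfl⟩)
      · exact Subtype.ext (hw _ ⟨1, rfl⟩))
    obtain ⟨a, ha⟩ := ih u' (fun i => huW _) hu' v (by rintro _ ⟨i, rfl⟩; exact hvK i)
    refine ⟨a, ?_⟩
    have hv : w = (u 0 ^ (p - 1) * u 1 ^ (p - 1)) • v := congrArg Subtype.val hv
    rw [hv, ha, smul_smul, Fin.prod_univ_succ, Fin.prod_univ_succ, ← mul_assoc]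
    rfl

section TruncAlg

variable {k : Type*} [Field k] {n p : ℕ}

theorem xGen_pow_eq_zero (i : Fin n) : xGen k n p i ^ p = 0 := by
  rw [xGen, ← map_pow, Ideal.Quotient.eq_zero_iff_mem]
  exact Ideal.subset_span ⟨i, rfl⟩

theorem xGen_pow_eq_zero_of_le (i : Fin n) {d : ℕ} (hd : p ≤ d) : xGen k n p i ^ d = 0 :=
  pow_eq_zero_of_le hd (xGen_pow_eq_zero i)

theorem prod_xGen_pow_eq_zero {e : Fin n → ℕ} {i : Fin n} (hi : p ≤ e i) :
    ∏ i, xGen k n p i ^ e i = 0 :=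
  Finset.prod_eq_zero (Finset.mem_univ i) (xGen_pow_eq_zero_of_le i hi)

theorem prod_xGen_pow_smul_eq_zero {M : Type*} [AddCommGroup M] [Module (TruncAlg k n p) M]
    {e : Fin n → ℕ} {i : Fin n} (hi : p ≤ e i) (m : M) : (∏ i, xGen k n p i ^ e i) • m = 0 := by
  rw [prod_xGen_pow_eq_zero hi]
  exact zero_smul (TruncAlg k n p) m

theorem mem_truncIdeal_iff (f : MvPolynomial (Fin n) k) :
    f ∈ truncIdeal k n p ↔ ∀ d ∈ f.support, ∃ i, p ≤ d i := by
  have : truncIdeal k n p = Ideal.span ((fun s => MvPolynomial.monomial s (1 : k)) ''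
      Set.range fun i : Fin n => Finsupp.single i p) := by
    rw [truncIdeal, ← Set.range_comp]
    simp only [Function.comp_def, MvPolynomial.X_pow_eq_monomial]
  rw [this, MvPolynomial.mem_ideal_span_monomial_image]
  simp

theorem annihilatorExact_xGen (S : Finset (Fin n)) :
    AnnihilatorExact (xGen k n p '' S) (∏ i ∈ S, xGen k n p i ^ (p - 1)) (TruncAlg k n p) := by
  intro a ha
  obtain ⟨f, rfl⟩ := Ideal.Quotient.mk_surjective a
  have hf (i : Fin n) (hi : i ∈ S) (d : Fin n →₀ ℕ) (hd : d ∈ f.support) :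
      (∃ j, p ≤ d j) ∨ p - 1 ≤ d i := by
    have h := ha _ ⟨i, hi, rfl⟩
    rw [xGen, smul_eq_mul, ← map_mul, Ideal.Quotient.eq_zero_iff_mem, mem_truncIdeal_iff] at h
    obtain ⟨j, hj⟩ := h (Finsupp.single i 1 + d) (by
      rw [MvPolynomial.mem_support_iff, MvPolynomial.coeff_X_mul]
      exact MvPolynomial.mem_support_iff.1 hd)
    by_cases hij : i = j
    · subst hij
      right
      simp at hj
      omega
    · left
      exact ⟨j, by simpa [Finsupp.single_apply, hij] using hj⟩
  suffices Ideal.Quotient.mk (truncIdeal k n p) f ∈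
      Ideal.span {∏ i ∈ S, xGen k n p i ^ (p - 1)} by
    obtain ⟨w, hw⟩ := Ideal.mem_span_singleton'.1 this
    exact ⟨w, by rw [← hw, smul_eq_mul, mul_comm]⟩
  rw [f.as_sum, map_sum]
  refine Ideal.sum_mem _ fun d hd => ?_
  by_cases hbad : ∃ j, p ≤ d j
  · convert Ideal.zero_mem _
    rw [Ideal.Quotient.eq_zero_iff_mem, mem_truncIdeal_iff]
    intro d' hd'
    rw [Finset.mem_singleton.1 (MvPolynomial.support_monomial_subset hd')]
    exact hbad
  · rw [MvPolynomial.monomial_eq, map_mul, Finsupp.prod_fintype _ _ (by simp), map_prod]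
    refine Ideal.mul_mem_left _ _ (Ideal.mem_span_singleton.2 ?_)
    refine (Finset.prod_dvd_prod_of_dvd _ _ fun i hi => ?_).trans
      (Finset.prod_dvd_prod_of_subset _ _ _ S.subset_univ)
    rw [map_pow]
    exact pow_dvd_pow _ ((hf i hi d hd).resolve_left hbad)

theorem exists_sub_algebraMap_mem_radIdeal (a : TruncAlg k n p) :
    ∃ c : k, a - algebraMap k _ c ∈ radIdeal k n p := by
  obtain ⟨f, rfl⟩ := Ideal.Quotient.mk_surjective a
  induction f using MvPolynomial.induction_on with
  | C c => exact ⟨c, by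
      convert Ideal.zero_mem _
      exact sub_self _⟩
  | add f g hf hg =>
    obtain ⟨c, hc⟩ := hf
    obtain ⟨d, hd⟩ := hg
    refine ⟨c + d, ?_⟩
    convert add_mem hc hd using 1
    rw [map_add, map_add]
    abel
  | mul_X f i _ =>
    refine ⟨0, ?_⟩
    rw [map_zero, sub_zero, map_mul]
    exact Ideal.mul_mem_left _ _ (Ideal.subset_span ⟨i, rfl⟩)

theorem mul_prod_xGen_eq_zero (hp : p ≠ 0) {a : TruncAlg k n p} (ha : a ∈ radIdeal k n p) :
    a * ∏ i, xGen k n p i ^ (p - 1) = 0 := by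
  have : radIdeal k n p ≤ LinearMap.ker
      (LinearMap.toSpanSingleton (TruncAlg k n p) _ (∏ i, xGen k n p i ^ (p - 1))) := by
    rw [radIdeal, Ideal.span_le]
    rintro _ ⟨i, rfl⟩
    rw [SetLike.mem_coe, LinearMap.mem_ker, LinearMap.toSpanSingleton_apply, smul_eq_mul,
      ← Finset.mul_prod_erase _ _ (Finset.mem_univ i), ← mul_assoc, ← pow_succ',
      Nat.sub_add_cancel (Nat.pos_of_ne_zero hp), xGen_pow_eq_zero, zero_mul]
  simpa using this ha

theorem prod_xGen_pow_add_single (e : Fin n → ℕ) (i : Fin n) :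
    ∏ j, xGen k n p j ^ (e + Pi.single i 1 : Fin n → ℕ) j = xGen k n p i * ∏ j, xGen k n p j ^ e j := by
  simp only [Pi.add_apply, pow_add, Finset.prod_mul_distrib]
  rw [mul_comm]
  congr 1
  rw [Finset.prod_eq_single i]
  · simp
  · intro j _ hj
    simp [hj]
  · simp

theorem free_of_annihilatorExact (hp : p ≠ 0) (M : Type*) [AddCommGroup M] [Module k M]
    [Module (TruncAlg k n p) M] [IsScalarTower k (TruncAlg k n p) M]
    (hM : AnnihilatorExact (Set.range (xGen k n p)) (∏ i, xGen k n p i ^ (p - 1)) M) :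
    Module.Free (TruncAlg k n p) M := by
  set N : TruncAlg k n p := ∏ i, xGen k n p i ^ (p - 1) with hN
  let soc : Submodule k M := ⨅ i, LinearMap.ker (Algebra.lsmul k k M (xGen k n p i))
  have mem_soc (m : M) : m ∈ soc ↔ ∀ i, xGen k n p i • m = 0 := by
    simp [soc, Submodule.mem_iInf]
  let b := Module.Basis.ofVectorSpace k soc
  have hb (j) : ∃ w : M, (b j : M) = N • w :=
    hM _ (by rintro _ ⟨i, rfl⟩; exact (mem_soc _).1 (b j).2 i)
  choose w hw using hb
  let F : Submodule (TruncAlg k n p) M := Submodule.span _ (Set.range w)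
  have hF (m : M) (hm : m ∈ soc) : ∃ f ∈ F, m = N • f := by
    have h1 : (⟨m, hm⟩ : soc) ∈ Submodule.span k (Set.range b) := b.span_eq ▸ Submodule.mem_top
    have h2 : Submodule.span k (Set.range b) ≤ ((F.restrictScalars k).map
        (Algebra.lsmul k k M N)).comap soc.subtype := by
      rw [Submodule.span_le]
      rintro _ ⟨j, rfl⟩
      exact ⟨w j, Submodule.subset_span ⟨j, rfl⟩, (hw j).symm⟩
    obtain ⟨f, hf, hfm⟩ := h2 h1
    exact ⟨f, hf, hfm.symm⟩
  have hgen (t : ℕ) : ∀ m : M, (∀ e : Fin n → ℕ, ∑ i, e i = t →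
      (∏ i, xGen k n p i ^ e i) • m = 0) → m ∈ F := by
    induction t with
    | zero =>
      intro m hm
      have := hm 0 (by simp)
      simp only [Pi.zero_apply, pow_zero, Finset.prod_const_one, one_smul] at this
      rw [this]
      exact zero_mem _
    | succ t ih =>
      intro m hm
      have hd (d : Fin n → ℕ) : ∃ f ∈ F, ∑ i, d i = t →
          (∏ i, xGen k n p i ^ d i) • m = N • f := by
        by_cases hd : ∑ i, d i = t
        · obtain ⟨f, hf, h⟩ := hF ((∏ i, xGen k n p i ^ d i) • m) ((mem_soc _).2 fun i => by
            rw [smul_smul, ← prod_xGen_pow_add_single]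
            apply hm
            simp [Finset.sum_add_distrib, hd])
          exact ⟨f, hf, fun _ => h⟩
        · exact ⟨0, zero_mem _, fun h => absurd h hd⟩
      choose f hfF hf using hd
      have hsum : ∑ d ∈ Finset.piAntidiag Finset.univ t,
          (∏ i, xGen k n p i ^ (p - 1 - d i)) • f d ∈ F :=
        sum_mem fun d _ => F.smul_mem _ (hfF d)
      rw [← sub_add_cancel m (∑ d ∈ Finset.piAntidiag Finset.univ t,
          (∏ i, xGen k n p i ^ (p - 1 - d i)) • f d)]
      refine add_mem (ih _ fun e he => ?_) hsum
      by_cases hbad : ∃ i, p ≤ e i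
      · obtain ⟨i, hi⟩ := hbad
        exact prod_xGen_pow_smul_eq_zero hi _
      push Not at hbad
      rw [smul_sub, hf e he, Finset.smul_sum, sub_eq_zero, Finset.sum_eq_single e]
      · rw [smul_smul, ← Finset.prod_mul_distrib, hN]
        congr 1
        refine Finset.prod_congr rfl fun i _ => ?_
        have := hbad i
        rw [← pow_add, show e i + (p - 1 - e i) = p - 1 by omega]
      · intro d hd hde
        have hd : ∑ i, d i = t := by simpa using hd
        obtain ⟨i, hi⟩ : ∃ i, d i < e i := by
          by_contra! h
          refine hde (funext fun i => le_antisymm ?_ (h i))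
          exact ((Finset.sum_eq_sum_iff_of_le fun i _ => h i).1 (he.trans hd.symm) i
            (Finset.mem_univ i)).ge
        rw [smul_smul, ← Finset.prod_mul_distrib]
        simp only [← pow_add]
        exact prod_xGen_pow_smul_eq_zero (i := i) (by omega) _
      · intro h
        exact absurd (by simpa using he) h
  have htop : F = ⊤ := by
    rw [eq_top_iff]
    rintro m -
    refine hgen (n * (p - 1) + 1) m fun e he => ?_
    obtain ⟨i, hi⟩ : ∃ i, p ≤ e i := by
      by_contra! h
      have := Finset.sum_le_card_nsmul Finset.univ e (p - 1) fun i _ => by have := h i; omega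
      rw [he, Finset.card_univ, Fintype.card_fin, smul_eq_mul] at this
      omega
    exact prod_xGen_pow_smul_eq_zero hi _
  have hli : LinearIndependent (TruncAlg k n p) w := by
    rw [linearIndependent_iff]
    intro c hc
    have hzero (t : ℕ) : ∀ s : ℕ, s + t = n * (p - 1) + 1 → ∀ e : Fin n → ℕ, ∑ i, e i = s →
        (∏ i, xGen k n p i ^ e i) • c = 0 := by
      induction t with
      | zero =>
        intro s hs e he
        obtain ⟨i, hi⟩ : ∃ i, p ≤ e i := by
          by_contra! h
          have := Finset.sum_le_card_nsmul Finset.univ e (p - 1) fun i _ => by have := h i; omega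
          rw [he, Finset.card_univ, Fintype.card_fin, smul_eq_mul] at this
          omega
        exact prod_xGen_pow_smul_eq_zero hi _
      | succ t ih =>
        intro s hs e he
        have hj (j) : ∃ l : k, (∏ i, xGen k n p i ^ e i) * c j = l • N := by
          obtain ⟨a, ha⟩ := annihilatorExact_xGen (k := k) (p := p) Finset.univ
            ((∏ i, xGen k n p i ^ e i) * c j) (by
            rintro _ ⟨i, -, rfl⟩
            have := DFunLike.congr_fun (ih (s + 1) (by omega) (e + Pi.single i 1)
              (by simp [Finset.sum_add_distrib, he])) j
            rw [prod_xGen_pow_add_single] at this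
            rw [smul_eq_mul, ← mul_assoc]
            exact this)
          obtain ⟨l, hl⟩ := exists_sub_algebraMap_mem_radIdeal a
          refine ⟨l, ?_⟩
          have := mul_prod_xGen_eq_zero hp hl
          rw [sub_mul, sub_eq_zero] at this
          rw [ha, smul_eq_mul, mul_comm, this]
          exact (Algebra.smul_def _ _).symm
        choose l hl using hj
        have hsum : ∑ j ∈ c.support, l j • b j = 0 := by
          apply Subtype.ext
          rw [Submodule.coe_sum, Submodule.coe_zero]
          have := congrArg (fun m => (∏ i, xGen k n p i ^ e i) • m) hc
          simp only [smul_zero, Finsupp.linearCombination_apply, Finsupp.sum, Finset.smul_sum,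
            smul_smul, hl] at this
          rw [← this]
          refine Finset.sum_congr rfl fun j _ => ?_
          rw [Submodule.coe_smul, hw, smul_assoc]
        have hl0 := linearIndependent_iff'.1 b.linearIndependent _ _ hsum
        ext j
        rw [Finsupp.smul_apply, smul_eq_mul, hl]
        by_cases hjs : j ∈ c.support
        · rw [hl0 j hjs, zero_smul]
          rfl
        · rw [← hl, Finsupp.notMem_support_iff.1 hjs, mul_zero]
          rfl
    simpa using hzero (n * (p - 1) + 1) 0 (by simp) 0 (by simp)
  exact Module.Free.of_basis (Module.Basis.mk hli htop.ge)

theorem exists_algHom_xGen {B : Type*} [CommRing B] [Algebra k B] (y : Fin n → B)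
    (hy : ∀ i, y i ^ p = 0) : ∃ α : TruncAlg k n p →ₐ[k] B, ∀ i, α (xGen k n p i) = y i := by
  have h : truncIdeal k n p ≤ RingHom.ker (MvPolynomial.aeval (R := k) y) := by
    rw [truncIdeal, Ideal.span_le]
    rintro _ ⟨i, rfl⟩
    simp [RingHom.mem_ker, hy]
  refine ⟨Ideal.Quotient.liftₐ _ (MvPolynomial.aeval y) fun a ha => h ha, fun i => ?_⟩
  exact MvPolynomial.aeval_X y i

theorem exists_linearPart (hp : 2 ≤ p) :
    ∃ ℓ : TruncAlg k n p →ₗ[k] (Fin n → k), (∀ i, ℓ (xGen k n p i) = Pi.single i 1) ∧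
      ∀ a ∈ radIdeal k n p ^ 2, ℓ a = 0 := by
  obtain ⟨ψ, hψ⟩ := exists_algHom_xGen (k := k) (p := p)
    (fun i : Fin n => TrivSqZeroExt.inr (R := k) (Pi.single i (1 : k) : Fin n → k))
    (fun i => pow_eq_zero_of_le hp (by rw [sq, TrivSqZeroExt.inr_mul_inr]))
  have hrad : radIdeal k n p ≤
      RingHom.ker ((TrivSqZeroExt.fstHom k k (Fin n → k)).comp ψ) := by
    rw [radIdeal, Ideal.span_le]
    rintro _ ⟨i, rfl⟩
    simp [RingHom.mem_ker, hψ]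
  refine ⟨(TrivSqZeroExt.sndHom k (Fin n → k)).comp ψ.toLinearMap, fun i => ?_, fun a ha => ?_⟩
  · simp [hψ]
  · have : radIdeal k n p ^ 2 ≤ RingHom.ker ψ := by
      rw [sq, Ideal.mul_le]
      intro a ha b hb
      have ha : (ψ a).fst = 0 := hrad ha
      have hb : (ψ b).fst = 0 := hrad hb
      rw [RingHom.mem_ker, map_mul]
      ext <;> simp [ha, hb]
    have := this ha
    rw [RingHom.mem_ker] at this
    simp [this]

theorem nontrivial_truncAlg (hp : p ≠ 0) : Nontrivial (TruncAlg k n p) := by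
  obtain ⟨α, -⟩ := exists_algHom_xGen (k := k) (n := n) (p := p) (fun _ => (0 : k))
    (fun _ => zero_pow hp)
  exact α.toRingHom.domain_nontrivial

theorem charP_truncAlg [Fact p.Prime] [CharP k p] : CharP (TruncAlg k n p) p :=
  have := nontrivial_truncAlg (k := k) (n := n) (Fact.out : p.Prime).ne_zero
  charP_of_injective_algebraMap (algebraMap k (TruncAlg k n p)).injective p

theorem pow_eq_zero_of_mem_radIdeal [Fact p.Prime] [CharP k p] {a : TruncAlg k n p}
    (ha : a ∈ radIdeal k n p) : a ^ p = 0 := by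
  have := charP_truncAlg (k := k) (n := n) (p := p)
  obtain ⟨c, rfl⟩ := Ideal.mem_span_range_iff_exists_fun.1 ha
  rw [sum_pow_char]
  exact Finset.sum_eq_zero fun i _ => by rw [mul_pow, xGen_pow_eq_zero, mul_zero]

theorem exists_sub_sum_smul_xGen_mem {a : TruncAlg k n p} (ha : a ∈ radIdeal k n p) :
    ∃ c : Fin n → k, a - ∑ i, c i • xGen k n p i ∈ radIdeal k n p ^ 2 := by
  obtain ⟨b, rfl⟩ := Ideal.mem_span_range_iff_exists_fun.1 ha
  choose c hc using fun i => exists_sub_algebraMap_mem_radIdeal (b i)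
  refine ⟨c, ?_⟩
  rw [← Finset.sum_sub_distrib]
  refine Ideal.sum_mem _ fun i _ => ?_
  have : b i * xGen k n p i - c i • xGen k n p i =
      (b i - algebraMap k _ (c i)) * xGen k n p i := by
    rw [sub_mul]
    congr 1
    exact Algebra.smul_def (c i) (xGen k n p i)
  rw [this, sq]
  exact Ideal.mul_mem_mul (hc i) (Ideal.subset_span ⟨i, rfl⟩)

theorem finite_truncAlg (hp : 0 < p) : Module.Finite k (TruncAlg k n p) := by
  have hint : ∀ a : TruncAlg k n p, IsIntegral k a := by
    intro a
    obtain ⟨f, rfl⟩ := Ideal.Quotient.mk_surjective a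
    induction f using MvPolynomial.induction_on with
    | C c => exact isIntegral_algebraMap (R := k) (x := c)
    | add f g hf hg =>
      rw [map_add]
      exact hf.add hg
    | mul_X f i hf =>
      rw [map_mul]
      refine hf.mul (IsIntegral.of_pow hp ?_)
      change IsIntegral k (xGen k n p i ^ p)
      rw [xGen_pow_eq_zero]
      exact isIntegral_zero
  have : Algebra.IsIntegral k (TruncAlg k n p) := ⟨hint⟩
  exact Algebra.IsIntegral.finite

section Complement

variable {V : Submodule k (TruncAlg k n p)}

theorem finrank_eq_of_complement (hp : 2 ≤ p)
    (hV1 : V ⊓ Submodule.restrictScalars k ((radIdeal k n p) ^ 2 : Ideal (TruncAlg k n p)) = ⊥)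
    (hV2 : V ⊔ Submodule.restrictScalars k ((radIdeal k n p) ^ 2 : Ideal (TruncAlg k n p)) =
      Submodule.restrictScalars k (radIdeal k n p)) :
    FiniteDimensional k V ∧ Module.finrank k V = n := by
  obtain ⟨ℓ, hℓ, hℓ2⟩ := exists_linearPart (k := k) (n := n) hp
  have hinj : Function.Injective (ℓ ∘ₗ V.subtype) := by
    rw [← LinearMap.ker_eq_bot, LinearMap.ker_eq_bot']
    rintro ⟨v, hv⟩ h
    have h : ℓ v = 0 := h
    have hvr : v ∈ radIdeal k n p := by
      have : v ∈ Submodule.restrictScalars k (radIdeal k n p) := hV2 ▸ Submodule.mem_sup_left hv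
      exact this
    obtain ⟨c, hc⟩ := exists_sub_sum_smul_xGen_mem hvr
    have h2 := hℓ2 _ hc
    have hc0 : c = 0 := by
      have h3 : ∑ i, c i • (Pi.single i 1 : Fin n → k) = c := by
        ext j
        simp [Finset.sum_apply, Pi.single_apply]
      rw [map_sub, h, map_sum, zero_sub, neg_eq_zero] at h2
      simp only [map_smul, hℓ] at h2
      rw [← h3, h2]
    subst hc0
    have hv2 : v ∈ radIdeal k n p ^ 2 := by
      simpa using hc
    have : v ∈ V ⊓ Submodule.restrictScalars k ((radIdeal k n p) ^ 2) := ⟨hv, hv2⟩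
    rw [hV1, Submodule.mem_bot] at this
    exact Subtype.ext this
  have hsurj : Function.Surjective (ℓ ∘ₗ V.subtype) := by
    rw [← LinearMap.range_eq_top, eq_top_iff, ← (Pi.basisFun k (Fin n)).span_eq, Submodule.span_le]
    rintro _ ⟨i, rfl⟩
    have hx : xGen k n p i ∈ Submodule.restrictScalars k (radIdeal k n p) :=
      Ideal.subset_span ⟨i, rfl⟩
    rw [← hV2] at hx
    obtain ⟨v, hv, w, hw, hvw⟩ := Submodule.mem_sup.1 hx
    refine ⟨⟨v, hv⟩, ?_⟩
    rw [Pi.basisFun_apply, ← hℓ i, ← hvw, map_add, hℓ2 w hw, add_zero]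
    rfl
  let e := LinearEquiv.ofBijective _ ⟨hinj, hsurj⟩
  exact ⟨Module.Finite.equiv e.symm, by rw [e.finrank_eq, Module.finrank_fin_fun]⟩

theorem le_radIdeal
    (hV2 : V ⊔ Submodule.restrictScalars k ((radIdeal k n p) ^ 2 : Ideal (TruncAlg k n p)) =
      Submodule.restrictScalars k (radIdeal k n p)) {v : TruncAlg k n p} (hv : v ∈ V) :
    v ∈ radIdeal k n p := by
  have : v ∈ Submodule.restrictScalars k (radIdeal k n p) := hV2 ▸ Submodule.mem_sup_left hv
  exact this

theorem radIdeal_le_of_complement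
    (hV2 : V ⊔ Submodule.restrictScalars k ((radIdeal k n p) ^ 2 : Ideal (TruncAlg k n p)) =
      Submodule.restrictScalars k (radIdeal k n p)) {I : Ideal (TruncAlg k n p)}
    (hI : ∀ v ∈ V, v ∈ I) : radIdeal k n p ≤ I := by
  refine Submodule.le_of_le_smul_of_le_jacobson_bot (I := radIdeal k n p)
    (IsNoetherian.noetherian _) ?_ ?_
  · refine le_trans ?_ (Ideal.radical_le_jacobson)
    rw [radIdeal, Ideal.span_le]
    rintro _ ⟨i, rfl⟩
    exact ⟨p, by rw [xGen_pow_eq_zero]; exact zero_mem _⟩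
  · intro a ha
    have ha : a ∈ Submodule.restrictScalars k (radIdeal k n p) := ha
    rw [← hV2] at ha
    obtain ⟨v, hv, w, hw, rfl⟩ := Submodule.mem_sup.1 ha
    refine add_mem (Submodule.mem_sup_left (hI v hv)) (Submodule.mem_sup_right ?_)
    rw [smul_eq_mul, ← sq]
    exact hw

theorem exists_linearIndependent_extension [FiniteDimensional k V] {v : TruncAlg k n p}
    (hv : v ∈ V) (hv0 : v ≠ 0) (m : ℕ) (hm : m + 1 ≤ Module.finrank k V) :
    ∃ u : Fin (m + 1) → TruncAlg k n p, (∀ i, u i ∈ V) ∧ LinearIndependent k u ∧ v ∈ Set.range u := by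
  suffices ∃ u : Fin (m + 1) → V, LinearIndependent k u ∧ ⟨v, hv⟩ ∈ Set.range u by
    obtain ⟨u, hu, i, hi⟩ := this
    exact ⟨fun i => u i, fun i => (u i).2, hu.map' V.subtype V.ker_subtype,
      i, congrArg Subtype.val hi⟩
  induction m with
  | zero =>
    refine ⟨fun _ => ⟨v, hv⟩, ?_, 0, rfl⟩
    rw [Nat.zero_add]
    exact linearIndependent_unique_iff.2 fun h => hv0 (congrArg Subtype.val h)
  | succ m ih =>
    obtain ⟨u, hu, i, hi⟩ := ih (by omega)
    obtain ⟨x, hx⟩ := exists_linearIndependent_cons_of_lt_finrank hu (by omega)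
    exact ⟨_, hx, i.succ, by simpa using hi⟩

/-- A linearly independent family of full size in a complement of `rad²` in `rad` gives a change
of variables. -/
theorem exists_bijective_algHom [Fact p.Prime] [CharP k p] [FiniteDimensional k V]
    (hV2 : V ⊔ Submodule.restrictScalars k ((radIdeal k n p) ^ 2 : Ideal (TruncAlg k n p)) =
      Submodule.restrictScalars k (radIdeal k n p)) (hVn : Module.finrank k V = n)
    (u : Fin n → TruncAlg k n p) (huV : ∀ i, u i ∈ V) (hu : LinearIndependent k u) :
    ∃ β : TruncAlg k n p →ₐ[k] TruncAlg k n p, Function.Bijective β ∧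
      (∀ i, β (xGen k n p i) = u i) ∧ Ideal.span (Set.range u) = radIdeal k n p := by
  obtain ⟨β, hβ⟩ := exists_algHom_xGen (k := k) u fun i =>
    pow_eq_zero_of_mem_radIdeal (le_radIdeal hV2 (huV i))
  have hspan : Submodule.span k (Set.range u) = V := by
    apply Submodule.eq_of_le_of_finrank_eq
    · rw [Submodule.span_le]
      rintro _ ⟨i, rfl⟩
      exact huV i
    · rw [finrank_span_eq_card hu, hVn, Fintype.card_fin]
  have hI : Ideal.span (Set.range u) = radIdeal k n p := by
    apply le_antisymm
    · rw [Ideal.span_le]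
      rintro _ ⟨i, rfl⟩
      exact le_radIdeal hV2 (huV i)
    · refine radIdeal_le_of_complement hV2 fun v hv => ?_
      rw [← hspan] at hv
      exact Submodule.span_le_restrictScalars k (TruncAlg k n p) _ hv
  have hsurj (t : ℕ) (a : TruncAlg k n p) : ∃ b, a - β b ∈ radIdeal k n p ^ t := by
    induction t generalizing a with
    | zero => exact ⟨0, by simp⟩
    | succ t ih =>
      obtain ⟨c, hc⟩ := exists_sub_algebraMap_mem_radIdeal a
      rw [← hI] at hc
      obtain ⟨d, hd⟩ := Ideal.mem_span_range_iff_exists_fun.1 hc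
      choose b hb using fun i => ih (d i)
      refine ⟨algebraMap k _ c + ∑ i, b i * xGen k n p i, ?_⟩
      rw [map_add, AlgHom.commutes, ← sub_sub, ← hd, map_sum, ← Finset.sum_sub_distrib]
      refine Ideal.sum_mem _ fun i _ => ?_
      rw [map_mul, hβ, ← sub_mul,
        show radIdeal k n p ^ (t + 1) = radIdeal k n p ^ t * radIdeal k n p from
          Submodule.pow_succ _]
      exact Ideal.mul_mem_mul (hb i) (le_radIdeal hV2 (huV i))
  have hnil : IsNilpotent (radIdeal k n p) := by
    rw [Ideal.FG.isNilpotent_iff_le_nilradical (IsNoetherian.noetherian _)]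
    exact fun a ha => ⟨p, pow_eq_zero_of_mem_radIdeal ha⟩
  have := finite_truncAlg (k := k) (n := n) (Fact.out : p.Prime).pos
  have hβs : Function.Surjective β := by
    obtain ⟨t, ht⟩ := hnil
    intro a
    obtain ⟨b, hb⟩ := hsurj t a
    rw [ht] at hb
    exact ⟨b, (sub_eq_zero.1 hb).symm⟩
  exact ⟨β, ⟨(LinearMap.injective_iff_surjective (f := β.toLinearMap)).2 hβs, hβs⟩, hβ, hI⟩

theorem annihilatorExact_truncAlg_of_complement [Fact p.Prime] [CharP k p]
    (hV1 : V ⊓ Submodule.restrictScalars k ((radIdeal k n p) ^ 2 : Ideal (TruncAlg k n p)) = ⊥)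
    (hV2 : V ⊔ Submodule.restrictScalars k ((radIdeal k n p) ^ 2 : Ideal (TruncAlg k n p)) =
      Submodule.restrictScalars k (radIdeal k n p)) {v : TruncAlg k n p} (hv : v ∈ V)
    (hv0 : v ≠ 0) : AnnihilatorExact {v} (v ^ (p - 1)) (TruncAlg k n p) := by
  obtain ⟨hfin, hVn⟩ := finrank_eq_of_complement (Fact.out : p.Prime).two_le hV1 hV2
  obtain ⟨m, rfl⟩ : ∃ m, n = m + 1 := by
    refine Nat.exists_eq_succ_of_ne_zero ?_
    rintro rfl
    have := Module.finrank_zero_iff.1 hVn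
    exact hv0 (congrArg Subtype.val (Subsingleton.elim (⟨v, hv⟩ : V) 0))
  obtain ⟨u, huV, hu, i, rfl⟩ := exists_linearIndependent_extension hv hv0 m hVn.ge
  obtain ⟨β, hβ, hβu, -⟩ := exists_bijective_algHom hV2 hVn u huV hu
  intro a ha
  obtain ⟨b, rfl⟩ := hβ.2 a
  have hb : xGen k (m + 1) p i * b = 0 := by
    apply hβ.1
    rw [map_mul, hβu, map_zero]
    exact ha _ rfl
  obtain ⟨w, hw⟩ := annihilatorExact_xGen (k := k) (p := p) {i} b (by
    rintro _ ⟨j, hj, rfl⟩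
    rw [Finset.mem_singleton.1 hj]
    exact hb)
  refine ⟨β w, ?_⟩
  rw [hw, Finset.prod_singleton, smul_eq_mul, map_mul, map_pow, hβu]
  rfl

end Complement

end TruncAlg

theorem AnnihilatorExact.of_projective {R : Type*} [CommRing R] {S : Set R} {N : R}
    (h : AnnihilatorExact S N R) (M : Type*) [AddCommGroup M] [Module R M]
    [Module.Projective R M] : AnnihilatorExact S N M := by
  obtain ⟨s, hs⟩ := Module.projective_def'.1 (inferInstance : Module.Projective R M)
  intro m hm
  have hj (j : M) : ∃ c : R, s m j = N * c := h (s m j) fun a ha => by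
    have := DFunLike.congr_fun (congrArg s (hm a ha)) j
    simpa using this
  choose c hc using hj
  have key := LinearMap.congr_fun hs m
  simp only [LinearMap.comp_apply, Finsupp.linearCombination_apply, Finsupp.sum, hc, mul_smul,
    ← Finset.smul_sum, LinearMap.id_apply] at key
  exact ⟨_, key.symm⟩

theorem annihilatorExact_of_isFreeVia {k : Type*} [Field k] {p r : ℕ} {A : Type*} [CommRing A]
    [Algebra k A] (α : TruncAlg k r p →ₐ[k] A) (M : Type*) [AddCommGroup M] [Module A M]
    (h : IsFreeVia α.toRingHom M) (i : Fin r) :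
    AnnihilatorExact {α (xGen k r p i)} (α (xGen k r p i) ^ (p - 1)) M := by
  let : Module (TruncAlg k r p) M := Module.compHom M α.toRingHom
  have : Module.Free (TruncAlg k r p) M := h
  intro m hm
  obtain ⟨w, hw⟩ := (annihilatorExact_xGen (k := k) (p := p) {i}).of_projective M m (by
    rintro _ ⟨j, hj, rfl⟩
    rw [Finset.mem_singleton.1 hj]
    exact hm _ rfl)
  refine ⟨w, hw.trans ?_⟩
  rw [Finset.prod_singleton, ← map_pow]
  rfl

theorem isFreeVia_of_annihilatorExact {k : Type*} [Field k] {p r : ℕ} (hp : p ≠ 0) {A : Type*}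
    [CommRing A] [Algebra k A] (α : TruncAlg k r p →ₐ[k] A) (M : Type*) [AddCommGroup M]
    [Module k M] [Module A M] [IsScalarTower k A M]
    (h : AnnihilatorExact (Set.range fun i => α (xGen k r p i))
      (∏ i, α (xGen k r p i) ^ (p - 1)) M) : IsFreeVia α.toRingHom M := by
  let : Module (TruncAlg k r p) M := Module.compHom M α.toRingHom
  have : IsScalarTower k (TruncAlg k r p) M := ⟨fun c a m => by
    change α (c • a) • m = c • α a • m
    rw [map_smul, smul_assoc]⟩
  refine free_of_annihilatorExact hp M fun m hm => ?_
  obtain ⟨w, hw⟩ := h m (by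
    rintro _ ⟨i, rfl⟩
    exact hm _ ⟨i, rfl⟩)
  refine ⟨w, hw.trans ?_⟩
  simp only [← map_pow, ← map_prod]
  rfl

/-- Exactness for a full linearly independent family in a complement of `rad²` in `rad` implies
exactness for the standard generators. -/
theorem annihilatorExact_xGen_of_complement {k : Type*} [Field k] {n p : ℕ} [Fact p.Prime]
    [CharP k p] {V : Submodule k (TruncAlg k n p)} [FiniteDimensional k V]
    (hV2 : V ⊔ Submodule.restrictScalars k ((radIdeal k n p) ^ 2 : Ideal (TruncAlg k n p)) =
      Submodule.restrictScalars k (radIdeal k n p)) (hVn : Module.finrank k V = n)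
    (u : Fin n → TruncAlg k n p) (huV : ∀ i, u i ∈ V) (hu : LinearIndependent k u)
    (M : Type*) [AddCommGroup M] [Module (TruncAlg k n p) M]
    (h : AnnihilatorExact (Set.range u) (∏ i, u i ^ (p - 1)) M) :
    AnnihilatorExact (Set.range (xGen k n p)) (∏ i, xGen k n p i ^ (p - 1)) M := by
  obtain ⟨β, -, hβ, hI⟩ := exists_bijective_algHom hV2 hVn u huV hu
  have hN : ∏ i, u i ^ (p - 1) = β (∏ i, xGen k n p i ^ (p - 1)) := by
    simp only [map_prod, map_pow, hβ]
  have hkill : radIdeal k n p ≤ LinearMap.ker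
      (LinearMap.toSpanSingleton (TruncAlg k n p) _ (∏ i, u i ^ (p - 1))) := by
    rw [← hI, Ideal.span_le]
    rintro _ ⟨i, rfl⟩
    rw [SetLike.mem_coe, LinearMap.mem_ker, LinearMap.toSpanSingleton_apply, smul_eq_mul, hN,
      ← hβ i, ← map_mul, mul_prod_xGen_eq_zero (Fact.out : p.Prime).ne_zero, map_zero]
    exact Ideal.subset_span ⟨i, rfl⟩
  obtain ⟨a, ha⟩ := annihilatorExact_xGen (k := k) (p := p) Finset.univ (∏ i, u i ^ (p - 1)) (by
    rintro _ ⟨i, -, rfl⟩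
    exact hkill (Ideal.subset_span ⟨i, rfl⟩))
  intro m hm
  have hm' : radIdeal k n p ≤ LinearMap.ker (LinearMap.toSpanSingleton (TruncAlg k n p) M m) := by
    rw [radIdeal, Ideal.span_le]
    rintro _ ⟨i, rfl⟩
    exact hm _ ⟨i, rfl⟩
  obtain ⟨w, hw⟩ := h m (by
    rintro _ ⟨i, rfl⟩
    exact hm' (le_radIdeal hV2 (huV i)))
  exact ⟨a • w, by rw [hw, ha, smul_assoc]⟩

/-- Dade's lemma for rank `r` shifted subgroups: a finite-dimensional `A`-module `M` is
projective (equivalently, free) over `A` iff for every `r`-dimensional subspace `U ⊆ V`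
(presented by a linearly independent family `u₁,…,u_r` in `V`) the restriction
`α_U^*(M)` is free over `C = k[t₁,…,t_r]/(tᵢᵖ)`. -/
theorem statement3 {k : Type*} [Field k] [IsAlgClosed k] (p n r : ℕ) [Fact p.Prime]
    [CharP k p] (hr : 1 ≤ r) (hrn : r ≤ n)
    (V : Submodule k (TruncAlg k n p))
    (hV1 : V ⊓ Submodule.restrictScalars k ((radIdeal k n p) ^ 2 : Ideal (TruncAlg k n p)) = ⊥)
    (hV2 : V ⊔ Submodule.restrictScalars k ((radIdeal k n p) ^ 2 : Ideal (TruncAlg k n p)) =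
      Submodule.restrictScalars k (radIdeal k n p))
    (M : Type*) [AddCommGroup M] [Module k M] [Module (TruncAlg k n p) M]
    [IsScalarTower k (TruncAlg k n p) M] [FiniteDimensional k M] :
    Module.Projective (TruncAlg k n p) M ↔
      ∀ u : Fin r → TruncAlg k n p, (∀ i, u i ∈ V) → LinearIndependent k u →
        ∀ α : TruncAlg k r p →ₐ[k] TruncAlg k n p,
          (∀ i, α (xGen k r p i) = u i) → IsFreeVia α.toRingHom M := by
  have hp : p ≠ 0 := (Fact.out : p.Prime).ne_zero
  have := charP_truncAlg (k := k) (n := n) (p := p)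
  obtain ⟨hfin, hVn⟩ := finrank_eq_of_complement (Fact.out : p.Prime).two_le hV1 hV2
  have hVp : ∀ v ∈ V, v ^ p = 0 := fun v hv => pow_eq_zero_of_mem_radIdeal (le_radIdeal hV2 hv)
  constructor
  · intro hproj u huV hu α hα
    refine isFreeVia_of_annihilatorExact hp α M ?_
    simp only [hα]
    exact annihilatorExact_of_forall_singleton p V hVp
      (fun v hv hv0 => (annihilatorExact_truncAlg_of_complement hV1 hV2 hv hv0).of_projective M)
      r u huV hu
  · intro h
    obtain ⟨m, rfl⟩ : ∃ m, r = m + 1 := ⟨r - 1, by omega⟩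
    have hline : ∀ v ∈ V, v ≠ 0 → AnnihilatorExact {v} (v ^ (p - 1)) M := by
      intro v hv hv0
      obtain ⟨u, huV, hu, i, rfl⟩ := exists_linearIndependent_extension hv hv0 m (hrn.trans hVn.ge)
      obtain ⟨α, hα⟩ := exists_algHom_xGen (k := k) u fun i => hVp _ (huV i)
      rw [← hα i]
      exact annihilatorExact_of_isFreeVia α M (h u huV hu α hα) i
    let b := Module.finBasisOfFinrankEq k V hVn
    have hb : LinearIndependent k fun i => (b i : TruncAlg k n p) :=
      b.linearIndependent.map' V.subtype V.ker_subtype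
    have := free_of_annihilatorExact hp M (annihilatorExact_xGen_of_complement hV2 hVn _
      (fun i => (b i).2) hb M (annihilatorExact_of_forall_singleton p V hVp hline n _
        (fun i => (b i).2) hb))
    exact Module.Projective.of_free

end
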